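/- arXiv:1607.03728 — 2 statements merged into one kernel-verified Lean document; each statement's English description precedes it below -/
import Mathlib

section
/- Let $k, m$ be integers with $0 \le k \le \ell-1$ and $0 \le m \le \ell-1$. Suppose that for every integer $p$ one has $\xi^{(2p-1)(\mu_1+2\mu_2)}\,[\mu_2]\,[\mu_2+\mu_1+1] = \xi^{(2p-1)(\mu_1+2\mu_2+k+2m)}\,[\mu_2+m]\,[\mu_2+\mu_1+k+m+1]$. Then $k = 0$ and $m = 0$. -/
open Complex

/-- `ξ^x = exp(2πix/ℓ)`. -/
noncomputable def xi (ℓ : ℤ) (x : ℂ) : ℂ := Complex.exp (2 * (Real.pi : ℂ) * Complex.I * x / (ℓ : ℂ))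

/-- The quantum number `[x] = (ξ^x - ξ^{-x})/(ξ - ξ^{-1})`. -/
noncomputable def qbr (ℓ : ℤ) (x : ℂ) : ℂ := (xi ℓ x - xi ℓ (-x)) / (xi ℓ 1 - xi ℓ (-1))

theorem xi_add (ℓ : ℤ) (x y : ℂ) : xi ℓ (x + y) = xi ℓ x * xi ℓ y := by
  simp only [xi, ← Complex.exp_add]
  ring_nf

theorem xi_neg (ℓ : ℤ) (x : ℂ) : xi ℓ (-x) = (xi ℓ x)⁻¹ := by
  simp only [xi, ← Complex.exp_neg]
  ring_nf

theorem xi_ne_zero (ℓ : ℤ) (x : ℂ) : xi ℓ x ≠ 0 := Complex.exp_ne_zero _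

theorem xi_intCast_eq_one_iff {ℓ : ℤ} (hℓ : ℓ ≠ 0) (n : ℤ) : xi ℓ n = 1 ↔ ℓ ∣ n := by
  have hℓ' : (ℓ : ℂ) ≠ 0 := Int.cast_ne_zero.mpr hℓ
  have hπ : 2 * (Real.pi : ℂ) * Complex.I ≠ 0 := Complex.two_pi_I_ne_zero
  rw [xi, Complex.exp_eq_one_iff, dvd_def]
  refine exists_congr fun c => ?_
  rw [div_eq_iff hℓ', mul_comm (c : ℂ), mul_assoc _ (c : ℂ), mul_right_inj' hπ]
  rw [mul_comm ℓ]
  norm_cast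

/-- For odd `ℓ`, `ξ^n = ξ^{-n}` forces `ℓ ∣ n`. -/
theorem dvd_of_xi_sq_eq_one {ℓ : ℤ} (hodd : Odd ℓ) {n : ℤ} (h : xi ℓ n * xi ℓ n = 1) :
    ℓ ∣ n := by
  have hℓ : ℓ ≠ 0 := by
    rintro rfl
    simp at hodd
  have h2 : ℓ ∣ 2 * n := by
    rw [← xi_intCast_eq_one_iff hℓ, two_mul, Int.cast_add, xi_add, h]
  have hc : IsCoprime ℓ 2 := by
    obtain ⟨c, rfl⟩ := hodd
    exact ⟨1, -c, by ring⟩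
  exact hc.dvd_of_dvd_mul_left h2

theorem xi_eq_xi_neg_of_qbr_eq_zero {ℓ : ℤ} (hℓ : xi ℓ 1 - xi ℓ (-1) ≠ 0) {x : ℂ}
    (h : qbr ℓ x = 0) : xi ℓ x = xi ℓ (-x) := by
  rw [qbr, div_eq_zero_iff, or_iff_left hℓ] at h
  exact sub_eq_zero.mp h

/-- The product identity `[a][b] - [a+m][b-m] = -[m][b-a-m]`. -/
theorem qbr_mul_sub_qbr_mul (ℓ : ℤ) (a b m : ℂ) :
    qbr ℓ a * qbr ℓ b - qbr ℓ (a + m) * qbr ℓ (b - m) = -(qbr ℓ m * qbr ℓ (b - a - m)) := by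
  simp only [qbr, sub_eq_add_neg b, sub_eq_add_neg (b + -a), neg_add, neg_neg, xi_add, xi_neg]
  have := xi_ne_zero ℓ a
  have := xi_ne_zero ℓ b
  have := xi_ne_zero ℓ m
  rw [div_mul_div_comm, div_mul_div_comm, div_mul_div_comm, ← sub_div, ← neg_div]
  congr 1
  field_simp
  ring

/-- Quantum numbers only depend on their argument modulo `ℓ`. -/
theorem qbr_add_of_xi_eq_one {ℓ : ℤ} (x : ℂ) {y : ℂ} (hy : xi ℓ y = 1) :
    qbr ℓ (x + y) = qbr ℓ x := by
  simp [qbr, xi_add, xi_neg, hy]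

/-- For a typical highest weight `(μ₁,μ₂)`, if the central characters agree,
i.e. `ξ^{(2p-1)(μ₁+2μ₂)}[μ₂][μ₂+μ₁+1] = ξ^{(2p-1)(μ₁+2μ₂+k+2m)}[μ₂+m][μ₂+μ₁+k+m+1]`
for all integers `p`, where `0 ≤ k, m ≤ ℓ-1`, then `k = 0` and `m = 0`. -/
theorem central_characters_separate
    (ℓ : ℤ) (hℓ3 : 3 ≤ ℓ) (hodd : Odd ℓ)
    (μ₁ μ₂ : ℂ)
    (htyp1 : ∀ p : ℤ, 1 ≤ p → p ≤ ℓ - 1 → qbr ℓ (μ₁ - (p : ℂ) + 1) ≠ 0)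
    (htyp2 : qbr ℓ μ₂ ≠ 0)
    (htyp3 : qbr ℓ (μ₁ + μ₂ + 1) ≠ 0)
    (k m : ℤ) (hk0 : 0 ≤ k) (hk1 : k ≤ ℓ - 1) (hm0 : 0 ≤ m) (hm1 : m ≤ ℓ - 1)
    (h : ∀ p : ℤ,
      xi ℓ ((2 * (p : ℂ) - 1) * (μ₁ + 2 * μ₂)) * qbr ℓ μ₂ * qbr ℓ (μ₂ + μ₁ + 1)
        = xi ℓ ((2 * (p : ℂ) - 1) * (μ₁ + 2 * μ₂ + (k : ℂ) + 2 * (m : ℂ)))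
            * qbr ℓ (μ₂ + (m : ℂ)) * qbr ℓ (μ₂ + μ₁ + (k : ℂ) + (m : ℂ) + 1)) :
    k = 0 ∧ m = 0 := by
  have hℓ0 : ℓ ≠ 0 := by omega
  have hden : xi ℓ 1 - xi ℓ (-1) ≠ 0 := fun h0 => htyp2 (by rw [qbr, h0, div_zero])
  have hS := xi_ne_zero ℓ (μ₁ + 2 * μ₂)
  have hT := xi_ne_zero ℓ ((k + 2 * m : ℤ) : ℂ)
  have e1 : qbr ℓ μ₂ * qbr ℓ (μ₂ + μ₁ + 1) = xi ℓ ((k + 2 * m : ℤ) : ℂ) *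
      (qbr ℓ (μ₂ + m) * qbr ℓ (μ₂ + μ₁ + k + m + 1)) := by
    have h1 := h 1
    have hs : (2 * ((1 : ℤ) : ℂ) - 1) * (μ₁ + 2 * μ₂) = μ₁ + 2 * μ₂ := by push_cast; ring
    have ht : (2 * ((1 : ℤ) : ℂ) - 1) * (μ₁ + 2 * μ₂ + k + 2 * m) =
        (μ₁ + 2 * μ₂) + ((k + 2 * m : ℤ) : ℂ) := by push_cast; ring
    rw [hs, ht, xi_add ℓ (μ₁ + 2 * μ₂)] at h1
    apply mul_left_cancel₀ hS
    linear_combination h1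
  have e0 : xi ℓ ((k + 2 * m : ℤ) : ℂ) * (qbr ℓ μ₂ * qbr ℓ (μ₂ + μ₁ + 1)) =
      qbr ℓ (μ₂ + m) * qbr ℓ (μ₂ + μ₁ + k + m + 1) := by
    have h0 := h 0
    have hs : (2 * ((0 : ℤ) : ℂ) - 1) * (μ₁ + 2 * μ₂) = -(μ₁ + 2 * μ₂) := by push_cast; ring
    have ht : (2 * ((0 : ℤ) : ℂ) - 1) * (μ₁ + 2 * μ₂ + k + 2 * m) =
        -(μ₁ + 2 * μ₂) + -((k + 2 * m : ℤ) : ℂ) := by push_cast; ring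
    rw [hs, ht, xi_add, xi_neg, xi_neg] at h0
    field_simp at h0
    linear_combination h0
  have hne : qbr ℓ μ₂ * qbr ℓ (μ₂ + μ₁ + 1) ≠ 0 :=
    mul_ne_zero htyp2 (by rwa [add_comm μ₂ μ₁])
  have hdvd : ℓ ∣ k + 2 * m := dvd_of_xi_sq_eq_one hodd <| by
    apply mul_right_cancel₀ hne
    rw [one_mul, mul_assoc, e0, ← e1]
  have hxi := (xi_intCast_eq_one_iff hℓ0 _).mpr hdvd
  have hb : μ₂ + μ₁ + k + m + 1 = (μ₂ + μ₁ + 1 - m) + ((k + 2 * m : ℤ) : ℂ) := by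
    push_cast; ring
  rw [hxi, one_mul, hb, qbr_add_of_xi_eq_one _ hxi] at e1
  have hprod := qbr_mul_sub_qbr_mul ℓ μ₂ (μ₂ + μ₁ + 1) m
  rw [sub_eq_zero.mpr e1, eq_comm, neg_eq_zero, mul_eq_zero] at hprod
  have hm : m = 0 := by
    rcases hprod with hm | hm
    · have hm' := xi_eq_xi_neg_of_qbr_eq_zero hden hm
      rw [xi_neg] at hm'
      have hsq : xi ℓ m * xi ℓ m = 1 := by
        nth_rewrite 2 [hm']
        exact mul_inv_cancel₀ (xi_ne_zero ℓ m)
      exact Int.eq_zero_of_dvd_of_nonneg_of_lt hm0 (by omega) (dvd_of_xi_sq_eq_one hodd hsq)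
    · by_contra hm_ne
      refine htyp1 m (by omega) hm1 ?_
      rw [← hm]
      congr 1
      ring
  subst hm
  exact ⟨Int.eq_zero_of_dvd_of_nonneg_of_lt hk0 (Int.lt_of_le_sub_one hk1) (by simpa using hdvd), rfl⟩
end

section
/- One has $N_1 = N_4 = \tfrac{1}{15}\big(-2\xi^{7/10}-2\xi^{3/5}-2\xi^{1/2}+2\xi^{2/5}+5\xi^{3/10}+2\xi^{1/10}\big)$, where $\xi^{x} = \exp(2\pi i x/3)$. (These are the values $N(M,\emptyset,\pm\omega_1)$ of the $3$-manifold invariant for the lens space $M = L(5,2)$, obtained by surgery on the Hopf link with framings $3$ and $2$, with cohomology classes $\omega_1$ and $\omega_4 = -\omega_1$.) -/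
open Complex

/-- `ξ^x = exp(2πix/3)` (the case `ℓ = 3`). -/
noncomputable def xi3 (x : ℂ) : ℂ := Complex.exp (2 * (Real.pi : ℂ) * Complex.I * x / 3)

/-- `{x} = ξ^x - ξ^{-x}`. -/
noncomputable def br3 (x : ℂ) : ℂ := xi3 x - xi3 (-x)

/-- The modified dimension `d(β₁,β₂) = {β₁}/(3{3β₁}{β₂}{β₁+β₂})`. -/
noncomputable def d3 (b₁ b₂ : ℂ) : ℂ := br3 b₁ / (3 * br3 (3 * b₁) * br3 b₂ * br3 (b₁ + b₂))

/-- The twist scalar `θ(β₁,β₂) = -ξ^{-2(β₂²+β₁β₂)}`. -/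
noncomputable def th3 (b₁ b₂ : ℂ) : ℂ := -xi3 (-2 * (b₂ ^ 2 + b₁ * b₂))

/-- The invariant `N_k = N(M,∅,ω_k)` of the lens space `L(5,2)` given by surgery on the Hopf
link with framings `3` and `2`, for the cohomology class `ω_k`, `k = 1,…,4`. -/
noncomputable def Nlens (k : ℕ) : ℂ :=
  ∑ s ∈ Finset.range 3, ∑ t ∈ Finset.range 3, ∑ i ∈ Finset.range 3, ∑ j ∈ Finset.range 3,
    d3 ((k : ℂ) / 5 - 2 + s) (2 * (k : ℂ) / 5 + 3 / 2 + t) *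
    d3 (2 * (k : ℂ) / 5 - 2 + i) (4 * (k : ℂ) / 5 + 3 / 2 + j) *
    th3 ((k : ℂ) / 5 - 2 + s) (2 * (k : ℂ) / 5 + 3 / 2 + t) ^ 3 *
    th3 (2 * (k : ℂ) / 5 - 2 + i) (4 * (k : ℂ) / 5 + 3 / 2 + j) ^ 2 *
    ((1 / 3) * xi3 (-4 * (4 * (k : ℂ) / 5 + 3 / 2 + j) * (2 * (k : ℂ) / 5 + 3 / 2 + t)
      - 2 * ((4 * (k : ℂ) / 5 + 3 / 2 + j) * ((k : ℂ) / 5 - 2 + s)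
        + (2 * (k : ℂ) / 5 - 2 + i) * (2 * (k : ℂ) / 5 + 3 / 2 + t))))

/-- The primitive 30th root of unity `ξ^{1/10}`. -/
noncomputable def zeta30 : ℂ := Complex.exp (2 * (Real.pi : ℂ) * Complex.I / (30 : ℕ))

lemma isPrimitiveRoot_zeta30 : IsPrimitiveRoot zeta30 30 :=
  Complex.isPrimitiveRoot_exp 30 (by norm_num)

lemma zeta30_ne_zero : zeta30 ≠ 0 := Complex.exp_ne_zero _

lemma xi3_eq_zpow {x : ℂ} (n : ℤ) (h : 10 * x = n) : xi3 x = zeta30 ^ n := by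
  rw [xi3, zeta30, ← Complex.exp_int_mul, ← h]
  congr 1
  push_cast
  ring

lemma zeta30_zpow_emod (n : ℤ) : zeta30 ^ (n % 30) = zeta30 ^ n := by
  have h : zeta30 ^ (30 : ℤ) = 1 := mod_cast isPrimitiveRoot_zeta30.pow_eq_one
  conv_rhs => rw [← Int.emod_add_mul_ediv n 30, zpow_add₀ zeta30_ne_zero, zpow_mul, h]
  simp

lemma cyclotomic_thirty_zeta30 :
    zeta30 ^ 8 + zeta30 ^ 7 - zeta30 ^ 5 - zeta30 ^ 4 - zeta30 ^ 3 + zeta30 + 1 = 0 := by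
  have h30 := isPrimitiveRoot_zeta30.pow_eq_one
  have h15 : zeta30 ^ 15 - 1 ≠ 0 := fun h =>
    absurd (isPrimitiveRoot_zeta30.dvd_of_pow_eq_one 15 (by linear_combination h)) (by norm_num)
  have h10 : zeta30 ^ 5 + 1 ≠ 0 := fun h =>
    absurd (isPrimitiveRoot_zeta30.dvd_of_pow_eq_one 10
      (by linear_combination (zeta30 ^ 5 - 1) * h)) (by norm_num)
  have h6 : zeta30 ^ 2 - zeta30 + 1 ≠ 0 := fun h =>
    absurd (isPrimitiveRoot_zeta30.dvd_of_pow_eq_one 6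
      (by linear_combination (zeta30 ^ 3 - 1) * (zeta30 + 1) * h)) (by norm_num)
  refine (mul_eq_zero.1 ?_).resolve_left (mul_ne_zero (mul_ne_zero h15 h10) h6)
  linear_combination h30

/-- The inverse of `ζ^n - 1` for `ζ = ξ^{1/10}`. -/
noncomputable def invSubOne (n : ℤ) : ℂ := (zeta30 ^ n - 1)⁻¹

lemma zeta30_zpow_ne_one {n : ℤ} (h : ¬ (30 : ℤ) ∣ n) : zeta30 ^ n - 1 ≠ 0 := fun h1 =>
  h ((isPrimitiveRoot_zeta30.zpow_eq_one_iff_dvd n).1 (sub_eq_zero.1 h1))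

lemma invSubOne_eq_of_mul_eq_one {n : ℕ} {p : ℂ} (h : p * (zeta30 ^ n - 1) = 1) :
    invSubOne n = p := by
  rw [invSubOne, zpow_natCast, eq_inv_of_mul_eq_one_left h]

lemma d3_eq {a b : ℂ} (m n : ℤ) (hb : 10 * b = m) (hab : 10 * (a + b) = n)
    (hm : ¬ (15 : ℤ) ∣ m) (hn : ¬ (15 : ℤ) ∣ n) :
    d3 a b = (1 / 3) * zeta30 ^ (3 * (n - m)) * invSubOne (6 * (n - m)) *
      (invSubOne (2 * m) - invSubOne (2 * n)) := by
  have hz := zeta30_ne_zero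
  have ha : 10 * a = (n - m : ℤ) := by push_cast; linear_combination hab - hb
  have br (x : ℂ) (l : ℤ) (h : 10 * x = l) :
      br3 x = (zeta30 ^ l)⁻¹ * (zeta30 ^ (2 * l) - 1) := by
    rw [br3, xi3_eq_zpow l h, xi3_eq_zpow (-l) (by push_cast; linear_combination -h), two_mul,
      zpow_add₀ hz, zpow_neg]
    field_simp
  have h3 := br (3 * a) (3 * (n - m)) (by push_cast at ha ⊢; linear_combination 3 * ha)
  rw [show 2 * (3 * (n - m)) = 6 * (n - m) by ring] at h3
  have hm' : zeta30 ^ (2 * m) - 1 ≠ 0 := zeta30_zpow_ne_one (by lia)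
  have hn' : zeta30 ^ (2 * n) - 1 ≠ 0 := zeta30_zpow_ne_one (by lia)
  have key : br3 a / (br3 b * br3 (a + b)) = invSubOne (2 * m) - invSubOne (2 * n) := by
    rw [br a _ ha, br b _ hb, br _ _ hab, invSubOne, invSubOne, inv_sub_inv hm' hn']
    simp only [mul_sub (2 : ℤ), zpow_sub₀ hz, two_mul, zpow_add₀ hz] at hm' hn' ⊢
    have := zpow_ne_zero m hz
    have := zpow_ne_zero n hz
    field_simp
    ring
  rw [← key, d3, h3, invSubOne]
  generalize zeta30 ^ (6 * (n - m)) - 1 = u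
  simp only [div_eq_mul_inv, mul_inv, inv_inv]
  ring

lemma th3_pow_mul_th3_pow_mul_xi3 (a b c e x : ℂ) :
    th3 a b ^ 3 * th3 c e ^ 2 * xi3 x =
      -xi3 (-6 * (b ^ 2 + a * b) - 4 * (e ^ 2 + c * e) + x) := by
  have h (u v w : ℂ) : (-exp u) ^ 3 * (-exp v) ^ 2 * exp w = -exp (3 * u + 2 * v + w) := by
    rw [exp_add, exp_add, show exp (3 * u) = exp u ^ 3 from mod_cast exp_nat_mul u 3,
      show exp (2 * v) = exp v ^ 2 from mod_cast exp_nat_mul v 2]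
    ring
  simp only [th3, xi3, h]
  ring_nf

lemma Nlens_summand_eq (k s t i j : ℕ) (hk : ¬ 5 ∣ k) :
    d3 ((k : ℂ) / 5 - 2 + s) (2 * (k : ℂ) / 5 + 3 / 2 + t) *
    d3 (2 * (k : ℂ) / 5 - 2 + i) (4 * (k : ℂ) / 5 + 3 / 2 + j) *
    th3 ((k : ℂ) / 5 - 2 + s) (2 * (k : ℂ) / 5 + 3 / 2 + t) ^ 3 *
    th3 (2 * (k : ℂ) / 5 - 2 + i) (4 * (k : ℂ) / 5 + 3 / 2 + j) ^ 2 *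
    ((1 / 3) * xi3 (-4 * (4 * (k : ℂ) / 5 + 3 / 2 + j) * (2 * (k : ℂ) / 5 + 3 / 2 + t)
      - 2 * ((4 * (k : ℂ) / 5 + 3 / 2 + j) * ((k : ℂ) / 5 - 2 + s)
        + (2 * (k : ℂ) / 5 - 2 + i) * (2 * (k : ℂ) / 5 + 3 / 2 + t)))) =
    -(1 / 27) * (zeta30 ^ (6 * (k : ℤ) % 30) * invSubOne (12 * k % 30) *
        zeta30 ^ (12 * (k : ℤ) % 30) * invSubOne (24 * k % 30)) *
      ((invSubOne ((8 * k + 20 * t) % 30) - invSubOne ((12 * k - 10 + 20 * (s + t)) % 30)) *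
       (invSubOne ((16 * k + 20 * j) % 30) - invSubOne ((24 * k - 10 + 20 * (i + j)) % 30)) *
       zeta30 ^ (-(72 * (k : ℤ) ^ 2 + k * (20 * (2 * (s + t) - 1) + 30 * (3 + 2 * t)
          + 20 * (2 * (i + j) - 1) + 30 * (3 + 2 * j))
          + 5 * (3 * (3 + 2 * t) * (2 * (s + t) - 1) + 2 * (3 + 2 * j) * (2 * (i + j) - 1)
          + (3 + 2 * j) * (2 * (s + t) - 1) + (3 + 2 * t) * (2 * (i + j) - 1))) % 30)) := by
  rw [d3_eq (4 * k + 15 + 10 * t) (6 * k - 5 + 10 * (s + t)) (by push_cast; ring)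
      (by push_cast; ring) (by lia) (by lia),
    d3_eq (8 * k + 15 + 10 * j) (12 * k - 5 + 10 * (i + j)) (by push_cast; ring)
      (by push_cast; ring) (by lia) (by lia)]
  have hexp (l m : ℤ) (h : (30 : ℤ) ∣ l - m) : zeta30 ^ l = zeta30 ^ (m % 30) := by
    rw [zeta30_zpow_emod, ← zeta30_zpow_emod l, ← zeta30_zpow_emod m,
      Int.emod_eq_emod_iff_emod_sub_eq_zero.2 (Int.emod_eq_zero_of_dvd h)]
  have hinv (l m : ℤ) (h : (30 : ℤ) ∣ l - m) : invSubOne l = invSubOne (m % 30) := by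
    rw [invSubOne, invSubOne, hexp l m h]
  rw [hexp (3 * _) (6 * k) (by lia), hexp (3 * _) (12 * k) (by lia),
    hinv (6 * _) (12 * k) (by lia), hinv (6 * _) (24 * k) (by lia),
    hinv (2 * (4 * k + 15 + 10 * t)) (8 * k + 20 * t) (by lia),
    hinv (2 * (6 * k - 5 + 10 * (s + t))) (12 * k - 10 + 20 * (s + t)) (by lia),
    hinv (2 * (8 * k + 15 + 10 * j)) (16 * k + 20 * j) (by lia),
    hinv (2 * (12 * k - 5 + 10 * (i + j))) (24 * k - 10 + 20 * (i + j)) (by lia),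
    zeta30_zpow_emod (-_)]
  have h := th3_pow_mul_th3_pow_mul_xi3 ((k : ℂ) / 5 - 2 + s) (2 * (k : ℂ) / 5 + 3 / 2 + t)
    (2 * (k : ℂ) / 5 - 2 + i) (4 * (k : ℂ) / 5 + 3 / 2 + j)
    (-4 * (4 * (k : ℂ) / 5 + 3 / 2 + j) * (2 * (k : ℂ) / 5 + 3 / 2 + t)
      - 2 * ((4 * (k : ℂ) / 5 + 3 / 2 + j) * ((k : ℂ) / 5 - 2 + s)
        + (2 * (k : ℂ) / 5 - 2 + i) * (2 * (k : ℂ) / 5 + 3 / 2 + t)))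
  rw [xi3_eq_zpow (x := _ + _) (-(72 * (k : ℤ) ^ 2 + k * (20 * (2 * (s + t) - 1) + 30 * (3 + 2 * t)
          + 20 * (2 * (i + j) - 1) + 30 * (3 + 2 * j))
          + 5 * (3 * (3 + 2 * t) * (2 * (s + t) - 1) + 2 * (3 + 2 * j) * (2 * (i + j) - 1)
          + (3 + 2 * j) * (2 * (s + t) - 1) + (3 + 2 * t) * (2 * (i + j) - 1))))
    (by push_cast; ring)] at h
  linear_combination (1 / 3) * (1 / 3 * zeta30 ^ (6 * (k : ℤ) % 30) * invSubOne (12 * k % 30) *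
    (invSubOne ((8 * k + 20 * t) % 30) - invSubOne ((12 * k - 10 + 20 * (s + t)) % 30))) *
    (1 / 3 * zeta30 ^ (12 * (k : ℤ) % 30) * invSubOne (24 * k % 30) *
    (invSubOne ((16 * k + 20 * j) % 30) - invSubOne ((24 * k - 10 + 20 * (i + j)) % 30))) * h

lemma invSubOne_2 :
    invSubOne 2 = -zeta30 ^ 6 - zeta30 ^ 5 - zeta30 ^ 4 + zeta30 :=
  invSubOne_eq_of_mul_eq_one (n := 2) (by grind [cyclotomic_thirty_zeta30])

lemma invSubOne_4 :
    invSubOne 4 = -zeta30 ^ 4 - zeta30 ^ 3 + zeta30 :=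
  invSubOne_eq_of_mul_eq_one (n := 4) (by grind [cyclotomic_thirty_zeta30])

lemma invSubOne_6 :
    invSubOne 6 = (-2 * zeta30 ^ 7 - 3 * zeta30 ^ 6 + zeta30 ^ 3 + 2 * zeta30 ^ 2 - 4) / 5 :=
  invSubOne_eq_of_mul_eq_one (n := 6) (by grind [cyclotomic_thirty_zeta30])

lemma invSubOne_8 :
    invSubOne 8 =
      zeta30 ^ 7 + zeta30 ^ 6 - zeta30 ^ 5 - zeta30 ^ 4 - zeta30 ^ 3 - zeta30 ^ 2 + zeta30 + 1 :=
  invSubOne_eq_of_mul_eq_one (n := 8) (by grind [cyclotomic_thirty_zeta30])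

lemma invSubOne_12 :
    invSubOne 12 = (-zeta30 ^ 7 + zeta30 ^ 6 - 2 * zeta30 ^ 3 + zeta30 ^ 2 - 2) / 5 :=
  invSubOne_eq_of_mul_eq_one (n := 12) (by grind [cyclotomic_thirty_zeta30])

lemma invSubOne_14 :
    invSubOne 14 = -zeta30 ^ 7 + zeta30 ^ 4 + zeta30 ^ 2 - zeta30 - 1 :=
  invSubOne_eq_of_mul_eq_one (n := 14) (by grind [cyclotomic_thirty_zeta30])

lemma invSubOne_16 :
    invSubOne 16 = zeta30 ^ 7 - zeta30 ^ 4 - zeta30 ^ 2 + zeta30 :=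
  invSubOne_eq_of_mul_eq_one (n := 16) (by grind [cyclotomic_thirty_zeta30])

lemma invSubOne_18 :
    invSubOne 18 = (zeta30 ^ 7 - zeta30 ^ 6 + 2 * zeta30 ^ 3 - zeta30 ^ 2 - 3) / 5 :=
  invSubOne_eq_of_mul_eq_one (n := 18) (by grind [cyclotomic_thirty_zeta30])

lemma invSubOne_22 :
    invSubOne 22 =
      -zeta30 ^ 7 - zeta30 ^ 6 + zeta30 ^ 5 + zeta30 ^ 4 + zeta30 ^ 3 + zeta30 ^ 2 - zeta30 - 2 :=
  invSubOne_eq_of_mul_eq_one (n := 22) (by grind [cyclotomic_thirty_zeta30])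

lemma invSubOne_24 :
    invSubOne 24 = (2 * zeta30 ^ 7 + 3 * zeta30 ^ 6 - zeta30 ^ 3 - 2 * zeta30 ^ 2 - 1) / 5 :=
  invSubOne_eq_of_mul_eq_one (n := 24) (by grind [cyclotomic_thirty_zeta30])

lemma invSubOne_26 :
    invSubOne 26 = zeta30 ^ 4 + zeta30 ^ 3 - zeta30 - 1 :=
  invSubOne_eq_of_mul_eq_one (n := 26) (by grind [cyclotomic_thirty_zeta30])

lemma invSubOne_28 :
    invSubOne 28 = zeta30 ^ 6 + zeta30 ^ 5 + zeta30 ^ 4 - zeta30 - 1 :=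
  invSubOne_eq_of_mul_eq_one (n := 28) (by grind [cyclotomic_thirty_zeta30])

lemma zeta30_pow_13 : zeta30 ^ 13 = -zeta30 ^ 7 + zeta30 ^ 5 + zeta30 ^ 4 - zeta30 - 1 := by
  grind [cyclotomic_thirty_zeta30]

lemma zeta30_pow_23 :
    zeta30 ^ 23 = zeta30 ^ 7 - zeta30 ^ 5 - zeta30 ^ 4 - zeta30 ^ 3 + zeta30 + 1 := by
  grind [cyclotomic_thirty_zeta30]

lemma Nlens_1 :
    Nlens 1 =
      (-2 * zeta30 ^ 7 - 2 * zeta30 ^ 6 - 2 * zeta30 ^ 5 + 2 * zeta30 ^ 4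
        + 5 * zeta30 ^ 3 + 2 * zeta30) / 15 := by
  simp only [Nlens, Nlens_summand_eq 1 _ _ _ _ (by norm_num), ← Finset.mul_sum]
  simp only [Finset.sum_range_succ, Finset.sum_range_zero, Nat.cast_ofNat, Nat.cast_zero,
    Nat.cast_one]
  norm_num only [zero_add]
  have h := cyclotomic_thirty_zeta30
  simp only [zpow_ofNat, invSubOne_2, invSubOne_4, invSubOne_6, invSubOne_8, invSubOne_12,
    invSubOne_14, invSubOne_16, invSubOne_18, invSubOne_22, invSubOne_24, invSubOne_26,
    invSubOne_28, zeta30_pow_13, zeta30_pow_23]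
  generalize zeta30 = z at *
  grind

lemma Nlens_4 :
    Nlens 4 =
      (-2 * zeta30 ^ 7 - 2 * zeta30 ^ 6 - 2 * zeta30 ^ 5 + 2 * zeta30 ^ 4
        + 5 * zeta30 ^ 3 + 2 * zeta30) / 15 := by
  simp only [Nlens, Nlens_summand_eq 4 _ _ _ _ (by norm_num), ← Finset.mul_sum]
  simp only [Finset.sum_range_succ, Finset.sum_range_zero, Nat.cast_ofNat, Nat.cast_zero,
    Nat.cast_one]
  norm_num only [zero_add]
  have h := cyclotomic_thirty_zeta30
  simp only [zpow_ofNat, invSubOne_2, invSubOne_4, invSubOne_6, invSubOne_8, invSubOne_12,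
    invSubOne_14, invSubOne_16, invSubOne_18, invSubOne_22, invSubOne_24, invSubOne_26,
    invSubOne_28, zeta30_pow_13, zeta30_pow_23]
  generalize zeta30 = z at *
  grind

/-- `N₁ = N₄ = (1/15)(-2ξ^{7/10}-2ξ^{3/5}-2ξ^{1/2}+2ξ^{2/5}+5ξ^{3/10}+2ξ^{1/10})`. -/
theorem lens_space_invariant_omega_one :
    Nlens 1 = Nlens 4 ∧
      Nlens 4 = (1 / 15) * (-2 * xi3 (7 / 10) - 2 * xi3 (3 / 5) - 2 * xi3 (1 / 2)
        + 2 * xi3 (2 / 5) + 5 * xi3 (3 / 10) + 2 * xi3 (1 / 10)) := by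
  refine ⟨Nlens_1.trans Nlens_4.symm, ?_⟩
  rw [Nlens_4, xi3_eq_zpow 7 (by norm_num), xi3_eq_zpow 6 (by norm_num),
    xi3_eq_zpow 5 (by norm_num), xi3_eq_zpow 4 (by norm_num), xi3_eq_zpow 3 (by norm_num),
    xi3_eq_zpow 1 (by norm_num)]
  simp only [zpow_ofNat]
  ring
end
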